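/- Let m ≥ 1 and H ≥ 1 be integers, V ∈ ℝ^S, and let (μ,ν) be an H-step lookahead policy for V. Let M : ℝ^S → ℝ^S be a linear map with ‖M‖_∞ ≤ δ_FV and ‖M J^{μ,ν} − J^{μ,ν}‖_∞ ≤ δ. Then ‖M(T_{μ,ν}^m(T^{H−1}V)) − T^{H−1}V‖_∞ ≤ ((1 + α^m·δ_FV)·α^{H−1}/(1−α))·‖TV − V‖_∞ + δ. -/

import Mathlib

open Finset Filter Topology Matrix

noncomputable section

/-- The probability simplex over a finite subset `D` of actions: nonnegative
weights summing to one over `D` and vanishing outside `D`. -/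
def simplex {A : Type*} [Fintype A] (D : Finset A) : Set (A → ℝ) :=
  {p | (∀ a, 0 ≤ p a) ∧ (∑ a ∈ D, p a = 1) ∧ ∀ a ∉ D, p a = 0}

/-- A finite two-player zero-sum discounted Markov game. `S` is the state space,
`A` the maximizer's global action type, `B` the minimizer's global action type. -/
structure MarkovGame (S A B : Type*) [Fintype S] [Fintype A] [Fintype B] where
  U : S → Finset A
  W : S → Finset B
  U_nonempty : ∀ s, (U s).Nonempty
  W_nonempty : ∀ s, (W s).Nonempty
  P : S → A → B → S → ℝ
  P_nonneg : ∀ s u v s', 0 ≤ P s u v s'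
  P_sum : ∀ s, ∀ u ∈ U s, ∀ v ∈ W s, ∑ s', P s u v s' = 1
  g : S → A → B → ℝ
  g_nonneg : ∀ s u v, 0 ≤ g s u v
  g_le_one : ∀ s u v, g s u v ≤ 1
  α : ℝ
  α_pos : 0 < α
  α_lt_one : α < 1

namespace MarkovGame

variable {S A B : Type*} [Fintype S] [Fintype A] [Fintype B]

/-- The state-action value matrix `A_{V,s}(u,v) = g(s,u,v) + α Σ_{s'} P(s'|s,u,v) V(s')`. -/
def Aval (G : MarkovGame S A B) (V : S → ℝ) (s : S) (u : A) (v : B) : ℝ :=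
  G.g s u v + G.α * ∑ s', G.P s u v s' * V s'

/-- A policy pair assigns to each state probability vectors over the available actions. -/
def IsPolicy (G : MarkovGame S A B) (μ : S → A → ℝ) (ν : S → B → ℝ) : Prop :=
  ∀ s, μ s ∈ simplex (G.U s) ∧ ν s ∈ simplex (G.W s)

/-- The Bellman operator of a policy pair: `(T_{μ,ν}V)(s) = μ(s)ᵀ A_{V,s} ν(s)`. -/
def Tpol (G : MarkovGame S A B) (μ : S → A → ℝ) (ν : S → B → ℝ) (V : S → ℝ) : S → ℝ :=
  fun s => ∑ u ∈ G.U s, ∑ v ∈ G.W s, μ s u * ν s v * G.Aval V s u v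

/-- The Bellman optimality operator:
`(TV)(s) = max_{p ∈ Δ(U(s))} min_{q ∈ Δ(V(s))} pᵀ A_{V,s} q`. -/
def T (G : MarkovGame S A B) (V : S → ℝ) : S → ℝ :=
  fun s => sSup {x | ∃ p ∈ simplex (G.U s),
    x = sInf {y | ∃ q ∈ simplex (G.W s),
      y = ∑ u ∈ G.U s, ∑ v ∈ G.W s, p u * q v * G.Aval V s u v}}

/-- The transition matrix `P_{μ,ν}` of a policy pair. -/
def Ppol (G : MarkovGame S A B) (μ : S → A → ℝ) (ν : S → B → ℝ) : Matrix S S ℝ :=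
  Matrix.of fun s s' => ∑ u ∈ G.U s, ∑ v ∈ G.W s, μ s u * ν s v * G.P s u v s'

/-- The expected one-step reward `g_{μ,ν}` of a policy pair. -/
def gpol (G : MarkovGame S A B) (μ : S → A → ℝ) (ν : S → B → ℝ) : S → ℝ :=
  fun s => ∑ u ∈ G.U s, ∑ v ∈ G.W s, μ s u * ν s v * G.g s u v

/-- `(μ,ν)` is an `H`-step lookahead policy for `V` if it is a policy pair and
`T_{μ,ν}(T^{H-1}V) = T^H V`. -/
def IsLookahead (G : MarkovGame S A B) (H : ℕ) (μ : S → A → ℝ) (ν : S → B → ℝ)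
    (V : S → ℝ) : Prop :=
  G.IsPolicy μ ν ∧ G.Tpol μ ν (G.T^[H - 1] V) = G.T^[H] V

end MarkovGame

theorem simplex_nonempty {A : Type*} [Fintype A] {D : Finset A} (hD : D.Nonempty) :
    (simplex D).Nonempty := by
  classical
  obtain ⟨a, ha⟩ := hD
  refine ⟨Pi.single a 1, fun b => ?_, ?_, fun b hb => ?_⟩
  · by_cases h : b = a
    · subst h; simp
    · simp [h]
  · simp [Pi.single_apply, ha]
  · have h : b ≠ a := fun h => hb (h ▸ ha)
    simp [h]

/-- A bilinear average of bounded entries is bounded. -/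
theorem abs_sum_simplex_le {A B : Type*} [Fintype A] [Fintype B] {D : Finset A} {E : Finset B}
    {p : A → ℝ} {q : B → ℝ} (hp : p ∈ simplex D) (hq : q ∈ simplex E) {X : A → B → ℝ} {C : ℝ}
    (hX : ∀ u ∈ D, ∀ v ∈ E, |X u v| ≤ C) :
    |∑ u ∈ D, ∑ v ∈ E, p u * q v * X u v| ≤ C := by
  calc |∑ u ∈ D, ∑ v ∈ E, p u * q v * X u v|
      ≤ ∑ u ∈ D, ∑ v ∈ E, p u * q v * C := by
        refine (Finset.abs_sum_le_sum_abs _ _).trans (Finset.sum_le_sum fun u hu => ?_)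
        refine (Finset.abs_sum_le_sum_abs _ _).trans (Finset.sum_le_sum fun v hv => ?_)
        have h := mul_nonneg (hp.1 u) (hq.1 v)
        rw [abs_mul, abs_of_nonneg h]
        exact mul_le_mul_of_nonneg_left (hX u hu v hv) h
    _ = C := by
        simp_rw [← Finset.sum_mul, ← Finset.mul_sum, hq.2.1, mul_one, hp.2.1, one_mul]

theorem sInf_image_le_add {Q : Type*} {s : Set Q} (hs : s.Nonempty) {f g : Q → ℝ} {c C : ℝ}
    (hf : ∀ q ∈ s, C ≤ f q) (h : ∀ q ∈ s, f q ≤ g q + c) :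
    sInf {y | ∃ q ∈ s, y = f q} ≤ sInf {y | ∃ q ∈ s, y = g q} + c := by
  obtain ⟨r, hr⟩ := hs
  rw [← sub_le_iff_le_add]
  refine le_csInf ⟨g r, r, hr, rfl⟩ ?_
  rintro _ ⟨q, hq, rfl⟩
  have hb : BddBelow {y | ∃ q ∈ s, y = f q} := ⟨C, by rintro _ ⟨q, hq, rfl⟩; exact hf q hq⟩
  have := csInf_le hb ⟨q, hq, rfl⟩
  linarith [h q hq]

theorem sSup_image_le_add {Q : Type*} {s : Set Q} (hs : s.Nonempty) {f g : Q → ℝ} {c C : ℝ}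
    (hg : ∀ q ∈ s, g q ≤ C) (h : ∀ q ∈ s, f q ≤ g q + c) :
    sSup {y | ∃ q ∈ s, y = f q} ≤ sSup {y | ∃ q ∈ s, y = g q} + c := by
  obtain ⟨r, hr⟩ := hs
  refine csSup_le ⟨f r, r, hr, rfl⟩ ?_
  rintro _ ⟨q, hq, rfl⟩
  have hb : BddAbove {y | ∃ q ∈ s, y = g q} := ⟨C, by rintro _ ⟨q, hq, rfl⟩; exact hg q hq⟩
  have := le_csSup hb ⟨q, hq, rfl⟩
  linarith [h q hq]

theorem norm_iterate_sub_iterate_le {E : Type*} [SeminormedAddCommGroup E] {f : E → E} {c : ℝ}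
    (hc : 0 ≤ c) (hf : ∀ x y, ‖f x - f y‖ ≤ c * ‖x - y‖) (n : ℕ) (x y : E) :
    ‖f^[n] x - f^[n] y‖ ≤ c ^ n * ‖x - y‖ := by
  induction n with
  | zero => simp
  | succ n ih =>
    rw [Function.iterate_succ_apply', Function.iterate_succ_apply', pow_succ', mul_assoc]
    exact (hf _ _).trans (mul_le_mul_of_nonneg_left ih hc)

namespace MarkovGame

variable {S A B : Type*} [Fintype S] [Fintype A] [Fintype B]

theorem abs_sum_P_mul_le (G : MarkovGame S A B) (V : S → ℝ) {s : S} {u : A} {v : B}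
    (hu : u ∈ G.U s) (hv : v ∈ G.W s) : |∑ s', G.P s u v s' * V s'| ≤ ‖V‖ := by
  calc |∑ s', G.P s u v s' * V s'| ≤ ∑ s', G.P s u v s' * ‖V‖ := by
        refine (Finset.abs_sum_le_sum_abs _ _).trans (Finset.sum_le_sum fun t _ => ?_)
        rw [abs_mul, abs_of_nonneg (G.P_nonneg s u v t)]
        exact mul_le_mul_of_nonneg_left (norm_le_pi_norm V t) (G.P_nonneg s u v t)
    _ = ‖V‖ := by rw [← Finset.sum_mul, G.P_sum s u hu v hv, one_mul]

theorem abs_Aval_le (G : MarkovGame S A B) (V : S → ℝ) {s : S} {u : A} {v : B}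
    (hu : u ∈ G.U s) (hv : v ∈ G.W s) : |G.Aval V s u v| ≤ 1 + G.α * ‖V‖ := by
  refine (abs_add_le _ _).trans (add_le_add ?_ ?_)
  · rw [abs_of_nonneg (G.g_nonneg s u v)]
    exact G.g_le_one s u v
  · rw [abs_mul, abs_of_pos G.α_pos]
    exact mul_le_mul_of_nonneg_left (G.abs_sum_P_mul_le V hu hv) G.α_pos.le

theorem abs_Aval_sub_le (G : MarkovGame S A B) (V V' : S → ℝ) {s : S} {u : A} {v : B}
    (hu : u ∈ G.U s) (hv : v ∈ G.W s) :
    |G.Aval V s u v - G.Aval V' s u v| ≤ G.α * ‖V - V'‖ := by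
  have h : G.Aval V s u v - G.Aval V' s u v = G.α * ∑ s', G.P s u v s' * (V - V') s' := by
    simp only [Aval, Pi.sub_apply, mul_sub, Finset.sum_sub_distrib]
    ring
  rw [h, abs_mul, abs_of_pos G.α_pos]
  exact mul_le_mul_of_nonneg_left (G.abs_sum_P_mul_le _ hu hv) G.α_pos.le

theorem abs_payoff_sub_le (G : MarkovGame S A B) (V V' : S → ℝ) (s : S) {p : A → ℝ} {q : B → ℝ}
    (hp : p ∈ simplex (G.U s)) (hq : q ∈ simplex (G.W s)) :
    |∑ u ∈ G.U s, ∑ v ∈ G.W s, p u * q v * G.Aval V s u v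
      - ∑ u ∈ G.U s, ∑ v ∈ G.W s, p u * q v * G.Aval V' s u v| ≤ G.α * ‖V - V'‖ := by
  simp_rw [← Finset.sum_sub_distrib, ← mul_sub]
  exact abs_sum_simplex_le hp hq fun u hu v hv => G.abs_Aval_sub_le V V' hu hv

theorem norm_Tpol_sub_le (G : MarkovGame S A B) {μ : S → A → ℝ} {ν : S → B → ℝ}
    (h : G.IsPolicy μ ν) (V V' : S → ℝ) :
    ‖G.Tpol μ ν V - G.Tpol μ ν V'‖ ≤ G.α * ‖V - V'‖ :=
  (pi_norm_le_iff_of_nonneg (mul_nonneg G.α_pos.le (norm_nonneg _))).2 fun s =>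
    G.abs_payoff_sub_le V V' s (h s).1 (h s).2

theorem T_le_add (G : MarkovGame S A B) (V V' : S → ℝ) (s : S) :
    G.T V s ≤ G.T V' s + G.α * ‖V - V'‖ := by
  have bound (X : S → ℝ) {p : A → ℝ} {q : B → ℝ} (hp : p ∈ simplex (G.U s))
      (hq : q ∈ simplex (G.W s)) :=
    abs_le.1 (abs_sum_simplex_le hp hq fun u hu v hv => G.abs_Aval_le X hu hv)
  have hW := simplex_nonempty (G.W_nonempty s)
  refine sSup_image_le_add (simplex_nonempty (G.U_nonempty s)) (C := 1 + G.α * ‖V'‖)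
    (fun p hp => ?_) fun p hp => ?_
  · obtain ⟨q, hq⟩ := hW
    refine le_trans (csInf_le ⟨-(1 + G.α * ‖V'‖), ?_⟩ ⟨q, hq, rfl⟩) (bound V' hp hq).2
    rintro _ ⟨r, hr, rfl⟩
    exact (bound V' hp hr).1
  · refine sInf_image_le_add hW (fun q hq => (bound V hp hq).1) fun q hq => ?_
    linarith [(abs_le.1 (G.abs_payoff_sub_le V V' s hp hq)).2]

theorem norm_T_sub_le (G : MarkovGame S A B) (V V' : S → ℝ) :
    ‖G.T V - G.T V'‖ ≤ G.α * ‖V - V'‖ := by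
  refine (pi_norm_le_iff_of_nonneg (mul_nonneg G.α_pos.le (norm_nonneg _))).2 fun s => ?_
  have h := G.T_le_add V' V s
  rw [norm_sub_rev] at h
  exact abs_sub_le_iff.2 ⟨by linarith [G.T_le_add V V' s], by linarith⟩

end MarkovGame


/-- If `(μ,ν)` is an `H`-step lookahead policy for `V`, `M` is a
linear map with `‖M‖_∞ ≤ δ_FV` and `‖M J^{μ,ν} − J^{μ,ν}‖_∞ ≤ δ`, then
`‖M(T_{μ,ν}^m(T^{H−1}V)) − T^{H−1}V‖_∞ ≤
  ((1 + α^m δ_FV) α^{H−1}/(1−α))‖TV − V‖_∞ + δ`. -/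
theorem stmt_15 {S A B : Type*} [Fintype S] [Fintype A] [Fintype B]
    (G : MarkovGame S A B) (m H : ℕ) (hm : 1 ≤ m) (hH : 1 ≤ H) (V : S → ℝ)
    (μ : S → A → ℝ) (ν : S → B → ℝ) (hLA : G.IsLookahead H μ ν V)
    (Jmn : S → ℝ) (hfix : G.Tpol μ ν Jmn = Jmn)
    (M : (S → ℝ) →L[ℝ] (S → ℝ)) (δFV δ : ℝ)
    (hM : ‖M‖ ≤ δFV) (happ : ‖M Jmn - Jmn‖ ≤ δ) :
    ‖M ((G.Tpol μ ν)^[m] (G.T^[H - 1] V)) - G.T^[H - 1] V‖ ≤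
      ((1 + G.α ^ m * δFV) * G.α ^ (H - 1) / (1 - G.α)) * ‖G.T V - V‖ + δ := by
  obtain ⟨hpol, hlook⟩ := hLA
  have hα := G.α_pos.le
  have hα1 : 0 < 1 - G.α := sub_pos.2 G.α_lt_one
  set X := G.T^[H - 1] V with hX
  have hstep : ‖G.Tpol μ ν X - X‖ ≤ G.α ^ (H - 1) * ‖G.T V - V‖ := by
    have hH' : G.T^[H] V = G.T^[H - 1] (G.T V) := by
      rw [← Function.iterate_succ_apply, Nat.succ_eq_add_one, Nat.sub_add_cancel hH]
    rw [hlook, hH', hX]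
    exact norm_iterate_sub_iterate_le hα G.norm_T_sub_le _ _ _
  have hdist : ‖X - Jmn‖ ≤ G.α ^ (H - 1) * ‖G.T V - V‖ / (1 - G.α) := by
    have h1 := G.norm_Tpol_sub_le hpol X Jmn
    rw [hfix] at h1
    have h2 := norm_sub_le_norm_sub_add_norm_sub X (G.Tpol μ ν X) Jmn
    rw [norm_sub_rev X (G.Tpol μ ν X)] at h2
    rw [le_div_iff₀ hα1]
    linarith
  have hiter : ‖(G.Tpol μ ν)^[m] X - Jmn‖ ≤ G.α ^ m * ‖X - Jmn‖ := by
    have h := norm_iterate_sub_iterate_le hα (G.norm_Tpol_sub_le hpol) m X Jmn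
    rwa [Function.iterate_fixed hfix] at h
  have hδ : 0 ≤ δFV := (norm_nonneg _).trans hM
  have hMiter : ‖M ((G.Tpol μ ν)^[m] X - Jmn)‖ ≤ δFV * (G.α ^ m * ‖X - Jmn‖) :=
    (M.le_of_opNorm_le hM _).trans (mul_le_mul_of_nonneg_left hiter hδ)
  have hsplit : M ((G.Tpol μ ν)^[m] X) - X
      = M ((G.Tpol μ ν)^[m] X - Jmn) + (M Jmn - Jmn) + (Jmn - X) := by
    rw [map_sub]
    abel
  calc ‖M ((G.Tpol μ ν)^[m] X) - X‖
      ≤ δFV * (G.α ^ m * ‖X - Jmn‖) + δ + ‖X - Jmn‖ := by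
        rw [hsplit, norm_sub_rev X]
        rw [norm_sub_rev X] at hMiter
        exact norm_add₃_le.trans (by linarith)
    _ = (1 + G.α ^ m * δFV) * ‖X - Jmn‖ + δ := by ring
    _ ≤ (1 + G.α ^ m * δFV) * (G.α ^ (H - 1) * ‖G.T V - V‖ / (1 - G.α)) + δ := by
        gcongr
    _ = _ := by ring
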